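/- arXiv:2407.09825 — 4 statements merged into one kernel-verified Lean document; each statement's English description precedes it below -/
import Mathlib

section
/- There are infinitely many rational face cuboids up to similarity. Equivalently, the set of triples (a, b, c) of positive rational numbers such that a² + b², b² + c², and a² + b² + c² are all squares of rational numbers, considered up to simultaneous multiplication of a, b, c by a common positive rational number, is infinite. -/
/-- Triples `(a, b, c)` of positive rationals such that `a² + b²`, `b² + c²`, and
`a² + b² + c²` are all squares of rationals — i.e. edge triples of rational face
cuboids. -/
def FaceCuboidTriples : Set (ℚ × ℚ × ℚ) :=
  {p | 0 < p.1 ∧ 0 < p.2.1 ∧ 0 < p.2.2 ∧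
    IsSquare (p.1 ^ 2 + p.2.1 ^ 2) ∧
    IsSquare (p.2.1 ^ 2 + p.2.2 ^ 2) ∧
    IsSquare (p.1 ^ 2 + p.2.1 ^ 2 + p.2.2 ^ 2)}

/-- A rational point of `w² = (x² - y²)(1 - x²y²)` with `1 < x` and `0 < y` yields a
face cuboid. -/
theorem mem_faceCuboidTriples_of_sq_eq {x y w : ℚ} (hx : 1 < x) (hy : 0 < y) (hw : w ≠ 0)
    (h : w ^ 2 = (x ^ 2 - y ^ 2) * (1 - x ^ 2 * y ^ 2)) :
    ((x ^ 2 - 1) * (1 + y ^ 2), 2 * |w|, 2 * y * (1 + x ^ 2)) ∈ FaceCuboidTriples := by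
  have hx2 : 0 < x ^ 2 - 1 := by nlinarith
  refine ⟨by positivity, by positivity, by positivity, ⟨(1 - y ^ 2) * (1 + x ^ 2), ?_⟩,
    ⟨2 * x * (1 + y ^ 2), ?_⟩, ⟨(1 + x ^ 2) * (1 + y ^ 2), ?_⟩⟩
  all_goals
    simp only [mul_pow, sq_abs, h]
    ring

/-- The abscissa `x` comes from tripling the point with abscissa `t` on
`t(t² - 1) v² = u³ - u`, and `y = x / t`. -/
theorem exists_sq_eq_of_ten_le {t : ℚ} (ht : 10 ≤ t) :
    ∃ x w : ℚ, 2 ≤ x ∧ x ≤ 3 ∧ w ≠ 0 ∧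
      w ^ 2 = (x ^ 2 - (x / t) ^ 2) * (1 - x ^ 2 * (x / t) ^ 2) := by
  have ht0 : 0 < t := by linarith
  have ht2 : 100 ≤ t ^ 2 := by nlinarith
  obtain ⟨m, hm⟩ : ∃ m, m = t ^ 4 + 6 * t ^ 2 - 3 := ⟨_, rfl⟩
  obtain ⟨n, hn⟩ : ∃ n, n = 3 * t ^ 4 - 6 * t ^ 2 - 1 := ⟨_, rfl⟩
  have hm0 : 0 < m := by nlinarith [sq_nonneg (t ^ 2)]
  obtain ⟨x, hx⟩ : ∃ x, x = n / m := ⟨_, rfl⟩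
  have hx2 : 2 ≤ x := by
    rw [hx, le_div_iff₀ hm0]
    nlinarith
  have hx3 : x ≤ 3 := by
    rw [hx, div_le_iff₀ hm0]
    nlinarith
  obtain ⟨w, hw⟩ : ∃ w : ℚ, w ^ 2 = (x ^ 2 - (x / t) ^ 2) * (1 - x ^ 2 * (x / t) ^ 2) := by
    have hfac : ((t ^ 2 - 1) * (t ^ 4 - 4 * t ^ 3 - 6 * t ^ 2 - 4 * t + 1) *
        (t ^ 4 + 4 * t ^ 3 - 6 * t ^ 2 + 4 * t + 1)) ^ 2 =
        (t ^ 2 - 1) * (t ^ 2 * m ^ 4 - n ^ 4) := by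
      rw [hm, hn]
      ring
    refine ⟨x * ((t ^ 2 - 1) * (t ^ 4 - 4 * t ^ 3 - 6 * t ^ 2 - 4 * t + 1) *
      (t ^ 4 + 4 * t ^ 3 - 6 * t ^ 2 + 4 * t + 1)) / (t ^ 2 * m ^ 2), ?_⟩
    rw [div_pow, mul_pow, hfac, hx]
    field_simp
  refine ⟨x, w, hx2, hx3, ?_, hw⟩
  have hy : x / t < x := div_lt_self (by linarith) (by linarith)
  have hy0 : 0 < x / t := by positivity
  have hxy : x * (x / t) < 1 := by
    rw [← mul_div_assoc, div_lt_one ht0]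
    nlinarith
  have hxy0 : 0 < x * (x / t) := by positivity
  have h₁ : 0 < x ^ 2 - (x / t) ^ 2 := by nlinarith
  have h₂ : 0 < 1 - x ^ 2 * (x / t) ^ 2 := by nlinarith
  intro h0
  have := mul_pos h₁ h₂
  rw [← hw, h0] at this
  norm_num at this

/-- Face cuboids with edge ratio `c / a` comparable to `1 / t`. -/
theorem exists_mem_faceCuboidTriples {t : ℚ} (ht : 10 ≤ t) :
    ∃ p ∈ FaceCuboidTriples, 2 * p.1 ≤ t * p.2.2 ∧ t * p.2.2 ≤ 10 * p.1 := by
  obtain ⟨x, w, hx2, hx3, hw, h⟩ := exists_sq_eq_of_ten_le ht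
  have ht0 : 0 < t := by linarith
  have hy0 : 0 < x / t := by positivity
  refine ⟨_, mem_faceCuboidTriples_of_sq_eq (by linarith) hy0 hw h, ?_⟩
  have hty : t * (2 * (x / t) * (1 + x ^ 2)) = 2 * x * (1 + x ^ 2) := by
    field_simp
  have hy1 : x / t ≤ 1 := by
    rw [div_le_one ht0]
    linarith
  dsimp only
  rw [hty]
  have hx4 : 4 ≤ x ^ 2 := by nlinarith
  have hysq : (x / t) ^ 2 ≤ 1 := by nlinarith
  have hysq0 : 0 ≤ (x / t) ^ 2 := sq_nonneg _
  constructor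
  · nlinarith
  · nlinarith

/-- There are infinitely many rational face cuboids up to similarity: there is a
sequence of face-cuboid edge triples which are pairwise non-proportional. -/
theorem stmt_11 :
    ∃ f : ℕ → ℚ × ℚ × ℚ, (∀ n, f n ∈ FaceCuboidTriples) ∧
      ∀ m n : ℕ,
        (∃ r : ℚ, 0 < r ∧ f n = (r * (f m).1, r * (f m).2.1, r * (f m).2.2)) → m = n := by
  have ht (n : ℕ) : (10 : ℚ) ≤ 10 ^ (n + 1) := le_self_pow₀ (by norm_num) n.succ_ne_zero
  choose f hf hlo hhi using fun n : ℕ => exists_mem_faceCuboidTriples (ht n)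
  have key {m n : ℕ} (hmn : m < n) : (f n).2.2 * (f m).1 < (f m).2.2 * (f n).1 := by
    obtain ⟨ham, -, hcm, -⟩ := hf m
    obtain ⟨han, -, hcn, -⟩ := hf n
    have hpow : (10 : ℚ) * 10 ^ (m + 1) ≤ 10 ^ (n + 1) := by
      rw [← pow_succ']
      exact pow_le_pow_right₀ (by norm_num) (by omega)
    have hT : (0 : ℚ) < 10 ^ (m + 1) := by positivity
    have h₁ : 10 ^ (m + 1) * (f n).2.2 ≤ (f n).1 := by
      nlinarith [hhi n, mul_le_mul_of_nonneg_right hpow hcn.le]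
    refine lt_of_mul_lt_mul_left ?_ hT.le
    nlinarith [mul_le_mul_of_nonneg_right h₁ ham.le,
      mul_le_mul_of_nonneg_right (hlo m) han.le, mul_pos ham han]
  refine ⟨f, hf, fun m n ⟨r, _, hr⟩ => ?_⟩
  have h : (f n).2.2 * (f m).1 = (f m).2.2 * (f n).1 := by
    rw [hr]
    ring
  rcases lt_trichotomy m n with hmn | hmn | hmn
  · exact absurd h (key hmn).ne
  · exact hmn
  · have := key hmn
    linarith
end

section
/- The set of rational numbers s with s ≠ 0, ±1 such that the group E_{1,s}(ℚ) contains a point of infinite order (equivalently, such that the rank of E_{1,s}(ℚ) is positive) is infinite. -/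
/-- The elliptic curve `E_{1,s} : y² = x(x − (2s)²)(x + (s²−1)²)` over `ℚ`. -/
def E1 (s : ℚ) : WeierstrassCurve.Affine ℚ :=
  { a₁ := 0, a₂ := (s ^ 2 - 1) ^ 2 - (2 * s) ^ 2, a₃ := 0,
    a₄ := -((2 * s) ^ 2 * (s ^ 2 - 1) ^ 2), a₆ := 0 }

/-- The ultrametric equality: a summand of smaller `p`-adic norm does not change the norm. -/
lemma padicNorm_add_eq_left {p : ℕ} [Fact p.Prime] {q r : ℚ}
    (h : padicNorm p r < padicNorm p q) : padicNorm p (q + r) = padicNorm p q := by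
  rw [padicNorm.add_eq_max_of_ne h.ne', max_eq_left h.le]

lemma padicNorm_pow {p : ℕ} [Fact p.Prime] (q : ℚ) (n : ℕ) :
    padicNorm p (q ^ n) = padicNorm p q ^ n := by
  induction n with
  | zero => simp
  | succ n ih => rw [pow_succ, pow_succ, padicNorm.mul, ih]

lemma padicNorm_two_two : padicNorm 2 2 = 1 / 2 := by
  have h := padicNorm.padicNorm_p_of_prime (p := 2)
  norm_num at h ⊢
  exact h

/-- The `2`-adic norm of the `x`-coordinate of a point, with value `0` at infinity. -/
def xNorm {W : WeierstrassCurve.Affine ℚ} : W.Point → ℚ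
  | .zero => 0
  | .some x _ _ => padicNorm 2 x

/-- On a `2`-integral curve `y² = x³ + a₂x² + a₄x`, doubling a point whose `x`-coordinate is not
`2`-integral multiplies the `2`-adic norm of the `x`-coordinate by `4`. -/
lemma xNorm_add_self {W : WeierstrassCurve.Affine ℚ} (h₁ : W.a₁ = 0) (h₃ : W.a₃ = 0)
    (h₆ : W.a₆ = 0) (h₂ : padicNorm 2 W.a₂ ≤ 1) (h₄ : padicNorm 2 W.a₄ ≤ 1)
    (P : W.Point) (hP : 1 < xNorm P) : xNorm (P + P) = 4 * xNorm P := by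
  rcases P with _ | ⟨x, y, h⟩
  · exact absurd hP (by norm_num [xNorm])
  change 1 < padicNorm 2 x at hP
  have hE : y ^ 2 = x ^ 3 + (W.a₂ * x ^ 2 + W.a₄ * x) := by
    have := (W.equation_iff x y).1 h.1
    rw [h₁, h₃, h₆] at this
    linarith
  have hpos : 0 < padicNorm 2 x := by linarith
  have hxx : padicNorm 2 x < padicNorm 2 x ^ 2 := by nlinarith
  have hxxx : padicNorm 2 x ^ 2 < padicNorm 2 x ^ 3 := by nlinarith [sq_nonneg (padicNorm 2 x)]
  have hy : padicNorm 2 y ^ 2 = padicNorm 2 x ^ 3 := by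
    rw [← padicNorm_pow, hE, padicNorm_add_eq_left, padicNorm_pow]
    refine padicNorm.nonarchimedean.trans_lt (max_lt ?_ ?_)
    · rw [padicNorm.mul, padicNorm_pow, padicNorm_pow]
      nlinarith [sq_nonneg (padicNorm 2 x)]
    · rw [padicNorm.mul, padicNorm_pow]
      nlinarith
  have hy0 : y ≠ 0 := by
    rintro rfl
    rw [padicNorm.zero] at hy
    have : 0 < padicNorm 2 x ^ 3 := by positivity
    linarith
  have hneg : W.negY x y = -y := by simp [WeierstrassCurve.Affine.negY, h₁, h₃]
  have hne : y ≠ W.negY x y := by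
    rw [hneg]
    intro h'
    exact hy0 (by linarith)
  have hX : W.addX x x (W.slope x x y y) = (x ^ 2 + -W.a₄) ^ 2 / (2 * y) ^ 2 := by
    rw [WeierstrassCurve.Affine.slope_of_Y_ne rfl hne, hneg, WeierstrassCurve.Affine.addX, h₁]
    have : y - -y ≠ 0 := by
      intro h'
      exact hy0 (by linarith)
    field_simp
    ring_nf
    rw [hE]
    ring
  rw [WeierstrassCurve.Affine.Point.add_self_of_Y_ne hne]
  change padicNorm 2 (W.addX x x (W.slope x x y y)) = 4 * padicNorm 2 x
  rw [hX, padicNorm.div, padicNorm_pow, padicNorm_pow, padicNorm.mul, mul_pow, hy,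
    padicNorm_add_eq_left, padicNorm_pow, padicNorm_two_two]
  · field_simp
    norm_num
  · rw [padicNorm.neg, padicNorm_pow]
    linarith

/-- On a `2`-integral curve `y² = x³ + a₂x² + a₄x`, a point whose `x`-coordinate is not
`2`-integral has infinite order. -/
lemma not_isOfFinAddOrder_of_one_lt_xNorm {W : WeierstrassCurve.Affine ℚ} (h₁ : W.a₁ = 0)
    (h₃ : W.a₃ = 0) (h₆ : W.a₆ = 0) (h₂ : padicNorm 2 W.a₂ ≤ 1) (h₄ : padicNorm 2 W.a₄ ≤ 1)
    (P : W.Point) (hP : 1 < xNorm P) : ¬ IsOfFinAddOrder P := by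
  intro hfin
  have hm : (AddSubmonoid.multiples P : Set W.Point).Finite := finite_multiples.2 hfin
  obtain ⟨Q, hQ, hmax⟩ := Set.exists_max_image _ xNorm hm ⟨P, AddSubmonoid.mem_multiples P⟩
  have hPQ := hmax P (AddSubmonoid.mem_multiples P)
  have hQQ := hmax (Q + Q) (add_mem hQ hQ)
  rw [xNorm_add_self h₁ h₃ h₆ h₂ h₄ Q (hP.trans_le hPQ)] at hQQ
  linarith

/-- The even (in the `2`-adic sense) nonzero `s` for which `s⁴ - (26/5)s² + 1` is a square. -/
def evenParams : Set ℚ :=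
  {s | s ≠ 0 ∧ padicNorm 2 s < 1 ∧ ∃ w : ℚ, w ^ 2 = s ^ 4 - 26 / 5 * s ^ 2 + 1}

lemma padicNorm_two_five : padicNorm 2 5 = 1 := by
  have := (padicNorm.nat_eq_one_iff (p := 2) 5).2 (by norm_num)
  exact_mod_cast this

lemma two_fifths_mem_evenParams : 2 / 5 ∈ evenParams := by
  refine ⟨by norm_num, ?_, 11 / 25, by norm_num⟩
  rw [padicNorm.div, padicNorm_two_two, padicNorm_two_five]
  norm_num

lemma padicNorm_eq_one_of_sq_eq {s w : ℚ} (h1 : padicNorm 2 s < 1)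
    (hw : w ^ 2 = s ^ 4 - 26 / 5 * s ^ 2 + 1) : padicNorm 2 w = 1 := by
  have hnn := padicNorm.nonneg (p := 2) s
  have hs2 : padicNorm 2 s ^ 2 < 1 := by nlinarith
  have hs4 : padicNorm 2 s ^ 4 < 1 := by nlinarith [sq_nonneg (padicNorm 2 s)]
  have : padicNorm 2 w ^ 2 = 1 := by
    rw [← padicNorm_pow, hw, show s ^ 4 - 26 / 5 * s ^ 2 + 1
      = 1 + (s ^ 4 + -(2 * 13 / 5 * s ^ 2)) by ring, padicNorm_add_eq_left, padicNorm.one]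
    rw [padicNorm.one]
    refine padicNorm.nonarchimedean.trans_lt (max_lt (by rwa [padicNorm_pow]) ?_)
    have h13 : padicNorm 2 13 ≤ 1 := by exact_mod_cast padicNorm.of_nat (p := 2) 13
    rw [padicNorm.neg, padicNorm.mul, padicNorm.div, padicNorm.mul, padicNorm_two_two,
      padicNorm_two_five, padicNorm_pow]
    nlinarith [sq_nonneg (padicNorm 2 s)]
  nlinarith [padicNorm.nonneg (p := 2) w]

/-- Doubling on the quartic `w² = s⁴ - (26/5)s² + 1` preserves `evenParams` and decreases the `2`-adic
norm of `s`. -/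
lemma exists_padicNorm_lt_of_mem_evenParams {s : ℚ} (hs : s ∈ evenParams) :
    ∃ s' ∈ evenParams, padicNorm 2 s' < padicNorm 2 s := by
  obtain ⟨h0, h1, w, hw⟩ := hs
  have hpos : 0 < padicNorm 2 s :=
    lt_of_le_of_ne (padicNorm.nonneg s) (padicNorm.nonzero h0).symm
  have hs2 : padicNorm 2 s ^ 2 < 1 := by nlinarith
  have hs4 : padicNorm 2 s ^ 4 < 1 := by nlinarith [sq_nonneg (padicNorm 2 s)]
  have hw1 := padicNorm_eq_one_of_sq_eq h1 hw
  have hd : padicNorm 2 (1 + -s ^ 4) = 1 := by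
    rw [padicNorm_add_eq_left, padicNorm.one]
    rwa [padicNorm.one, padicNorm.neg, padicNorm_pow]
  have hd0 : 1 + -s ^ 4 ≠ 0 := by
    intro h
    rw [h, padicNorm.zero] at hd
    norm_num at hd
  have hw0 : w ≠ 0 := by
    rintro rfl
    rw [padicNorm.zero] at hw1
    norm_num at hw1
  have hnorm : padicNorm 2 (2 * s * w / (1 + -s ^ 4)) = padicNorm 2 s / 2 := by
    rw [padicNorm.div, padicNorm.mul, padicNorm.mul, hd, hw1, padicNorm_two_two]
    ring
  refine ⟨2 * s * w / (1 + -s ^ 4), ⟨by positivity, by rw [hnorm]; linarith,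
    (s ^ 8 - 52 / 5 * s ^ 6 + 6 * s ^ 4 - 52 / 5 * s ^ 2 + 1) / (1 + -s ^ 4) ^ 2, ?_⟩,
    by rw [hnorm]; linarith⟩
  have h4 : w ^ 4 = (s ^ 4 - 26 / 5 * s ^ 2 + 1) ^ 2 := by rw [← hw]; ring
  simp only [div_pow, mul_pow, h4, hw]
  field_simp
  ring

lemma evenParams_infinite : evenParams.Infinite := by
  intro hfin
  obtain ⟨s, hs, hmin⟩ := Set.exists_min_image _ (padicNorm 2) hfin ⟨_, two_fifths_mem_evenParams⟩
  obtain ⟨s', hs', hlt⟩ := exists_padicNorm_lt_of_mem_evenParams hs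
  exact (hmin s' hs').not_gt hlt

lemma exists_not_isOfFinAddOrder_of_mem_evenParams {s : ℚ} (hs : s ∈ evenParams) :
    ∃ P : (E1 s).Point, ¬ IsOfFinAddOrder P := by
  obtain ⟨h0, h1, w, hw⟩ := hs
  have hnn := padicNorm.nonneg (p := 2) s
  have hs2 : padicNorm 2 s ^ 2 < 1 := by nlinarith
  have hb : padicNorm 2 (s ^ 2 - 1) = 1 := by
    rw [show s ^ 2 - 1 = -1 + s ^ 2 by ring, padicNorm_add_eq_left, padicNorm.neg, padicNorm.one]
    rwa [padicNorm.neg, padicNorm.one, padicNorm_pow]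
  have hb0 : s ^ 2 - 1 ≠ 0 := by
    intro h
    rw [h, padicNorm.zero] at hb
    norm_num at hb
  have ha : padicNorm 2 ((2 * s) ^ 2) ≤ 1 := by
    rw [padicNorm_pow, padicNorm.mul, padicNorm_two_two]
    nlinarith
  have hw0 : w ≠ 0 := by
    rintro rfl
    have hw1 := padicNorm_eq_one_of_sq_eq h1 hw
    rw [padicNorm.zero] at hw1
    norm_num at hw1
  have hns : (E1 s).Nonsingular (5 / 4 * (s ^ 2 - 1) ^ 2) (15 / 8 * (s ^ 2 - 1) ^ 2 * w) := by
    rw [WeierstrassCurve.Affine.nonsingular_iff', WeierstrassCurve.Affine.equation_iff]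
    refine ⟨?_, Or.inr ?_⟩
    · simp only [E1, mul_pow, hw]
      ring
    · simp only [E1]
      have : 2 * (15 / 8 * (s ^ 2 - 1) ^ 2 * w) ≠ 0 := by positivity
      simpa using this
  refine ⟨.some _ _ hns, not_isOfFinAddOrder_of_one_lt_xNorm rfl rfl rfl ?_ ?_ _ ?_⟩
  · refine padicNorm.sub.trans (max_le ?_ ha)
    rw [padicNorm_pow, hb]
    norm_num
  · change padicNorm 2 (-((2 * s) ^ 2 * (s ^ 2 - 1) ^ 2)) ≤ 1
    rw [padicNorm.neg, padicNorm.mul, padicNorm_pow (s ^ 2 - 1), hb]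
    simpa using ha
  · change 1 < padicNorm 2 (5 / 4 * (s ^ 2 - 1) ^ 2)
    rw [show (4 : ℚ) = 2 * 2 by norm_num, padicNorm.mul, padicNorm.div, padicNorm.mul, padicNorm_pow,
      hb, padicNorm_two_two, padicNorm_two_five]
    norm_num

theorem stmt_12 :
    {s : ℚ | s ≠ 0 ∧ s ≠ 1 ∧ s ≠ -1 ∧
      ∃ P : (E1 s).Point, ¬ IsOfFinAddOrder P}.Infinite := by
  refine evenParams_infinite.mono fun s hs => ⟨hs.1, ?_, ?_,
    exists_not_isOfFinAddOrder_of_mem_evenParams hs⟩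
  · rintro rfl
    have := hs.2.1
    rw [padicNorm.one] at this
    exact lt_irrefl _ this
  · rintro rfl
    have := hs.2.1
    rw [padicNorm.neg, padicNorm.one] at this
    exact lt_irrefl _ this
end

section
/- For every rational number t with t ≠ 0, ±1, the rational number t⁴ − 1 = (t²+1)(t²−1) is not the square of a rational number. -/
/-- Coprime integers, the first nonnegative, whose product is a nonzero square are both squares. -/
theorem Int.exists_sq_of_isCoprime_of_mul_eq_sq {m n k : ℤ} (hmn : IsCoprime m n)
    (hm : 0 ≤ m) (hk : k ≠ 0) (h : m * n = k ^ 2) : ∃ e f : ℤ, m = e ^ 2 ∧ n = f ^ 2 := by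
  have hk2 : 0 < k ^ 2 := by positivity
  have hn : 0 < n := by
    by_contra! hn
    nlinarith
  obtain ⟨e, he | he⟩ := Int.sq_of_isCoprime hmn h
  · obtain ⟨f, hf | hf⟩ := Int.sq_of_isCoprime hmn.symm (mul_comm m n ▸ h)
    · exact ⟨e, f, he, hf⟩
    · nlinarith [sq_nonneg f]
  · nlinarith [sq_nonneg e]

/-- A primitive solution of `s ^ 4 + 4 * r ^ 4 = a ^ 2` with `s` odd gives a solution of
`e ^ 4 = f ^ 4 + s ^ 2` with `|e| < a`. -/
theorem Int.exists_pow_four_eq_of_add_four_mul {r s a : ℤ} (hr : r ≠ 0) (hs : s % 2 = 1)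
    (hrs : IsCoprime r s) (ha : 0 < a) (h : s ^ 4 + 4 * r ^ 4 = a ^ 2) :
    ∃ e f : ℤ, f ≠ 0 ∧ IsCoprime e f ∧ e ^ 4 = f ^ 4 + s ^ 2 ∧ |e| < a := by
  have hs2 : IsCoprime s 2 := ⟨1, -(s / 2), by omega⟩
  have hgcd : Int.gcd (s ^ 2) (2 * r ^ 2) = 1 :=
    Int.isCoprime_iff_gcd_eq_one.mp (hs2.mul_right hrs.symm.pow_right).pow_left
  have hodd : s ^ 2 % 2 = 1 := by rw [pow_two, Int.mul_emod, hs]; rfl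
  have hp : PythagoreanTriple (s ^ 2) (2 * r ^ 2) a := by
    unfold PythagoreanTriple
    linear_combination h
  obtain ⟨u, v, h1, h2, h3, h4, -, hu⟩ := hp.coprime_classification' hgcd hodd ha
  have huv : IsCoprime u v := Int.isCoprime_iff_gcd_eq_one.mpr h4
  obtain ⟨e, f, rfl, rfl⟩ :=
    Int.exists_sq_of_isCoprime_of_mul_eq_sq huv hu hr (by linarith : u * v = r ^ 2)
  have hf : f ≠ 0 := by
    rintro rfl
    have : r ^ 2 = 0 := by linarith
    exact hr (pow_eq_zero_iff two_ne_zero |>.mp this)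
  refine ⟨e, f, hf, (IsCoprime.pow_iff two_pos two_pos).mp huv, by linear_combination -h1, ?_⟩
  have hf4 : 0 < (f ^ 2) ^ 2 := by positivity
  have he2 : |e| ≤ e ^ 2 := by
    rw [← sq_abs]
    exact Int.le_self_sq _
  have he4 : e ^ 2 ≤ (e ^ 2) ^ 2 := Int.le_self_sq _
  linarith

/-- The equation `a ^ 4 = b ^ 4 + c ^ 2` has no primitive integer solution with `b, c ≠ 0`. -/
theorem Int.pow_four_ne_pow_four_add_sq_of_isCoprime (a b c : ℤ) (hb : b ≠ 0) (hc : c ≠ 0)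
    (hab : IsCoprime a b) : a ^ 4 ≠ b ^ 4 + c ^ 2 := by
  induction hN : a.natAbs using Nat.strong_induction_on generalizing a b c with
  | _ N ih =>
  subst hN
  intro h
  have ha : a ≠ 0 := by
    rintro rfl
    have : 0 < b ^ 4 + c ^ 2 := by positivity
    linarith
  have ha2 : 0 < a ^ 2 := by positivity
  have hbc : IsCoprime (b ^ 2) c := by
    have h1 : IsCoprime (b ^ 2) (c ^ 2 + b ^ 2 * b ^ 2) := by
      rw [show c ^ 2 + b ^ 2 * b ^ 2 = a ^ 4 by linear_combination -h]
      exact hab.symm.pow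
    exact (IsCoprime.pow_right_iff two_pos).mp (IsCoprime.add_mul_left_right_iff.mp h1)
  rcases Int.emod_two_eq_zero_or_one b with hb2 | hb2
  · have hc2 : c % 2 = 1 := by
      by_contra hc2
      have h2b : (2 : ℤ) ∣ b ^ 2 := (Int.dvd_of_emod_eq_zero hb2).pow two_ne_zero
      have h2c : (2 : ℤ) ∣ c := by omega
      have := hbc.isUnit_of_dvd' h2b h2c
      rw [Int.isUnit_iff] at this
      omega
    have hp : PythagoreanTriple c (b ^ 2) (a ^ 2) := by
      unfold PythagoreanTriple
      linear_combination -h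
    obtain ⟨m, n, -, h2, h3, h4, h5, hm⟩ :=
      hp.coprime_classification' (Int.isCoprime_iff_gcd_eq_one.mp hbc.symm) hc2 ha2
    have hmn : IsCoprime m n := Int.isCoprime_iff_gcd_eq_one.mpr h4
    obtain ⟨d, rfl⟩ := Int.dvd_of_emod_eq_zero hb2
    have hd : d ≠ 0 := by
      rintro rfl
      simp at hb
    obtain ⟨r, s, hr, hs, hrs, hsum⟩ : ∃ r s : ℤ, r ≠ 0 ∧ s % 2 = 1 ∧ IsCoprime r s ∧
        s ^ 4 + 4 * r ^ 4 = |a| ^ 2 := by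
      have key : ∀ k l : ℤ, IsCoprime k l → l % 2 = 1 → k * l = d ^ 2 →
          (0 ≤ k ∨ 0 ≤ l) → a ^ 2 = (2 * k) ^ 2 + l ^ 2 → ∃ r s : ℤ, r ≠ 0 ∧ s % 2 = 1 ∧
          IsCoprime r s ∧ s ^ 4 + 4 * r ^ 4 = |a| ^ 2 := by
        intro k l hkl hl hprod hpos hsq
        obtain ⟨r, s, rfl, rfl⟩ : ∃ r s : ℤ, k = r ^ 2 ∧ l = s ^ 2 := by
          rcases hpos with hk | hl
          · exact Int.exists_sq_of_isCoprime_of_mul_eq_sq hkl hk hd hprod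
          · obtain ⟨s, r, h, h'⟩ := Int.exists_sq_of_isCoprime_of_mul_eq_sq hkl.symm hl hd
              (mul_comm k l ▸ hprod)
            exact ⟨r, s, h', h⟩
        refine ⟨r, s, ?_, ?_, (IsCoprime.pow_iff two_pos two_pos).mp hkl, ?_⟩
        · rintro rfl
          exact pow_ne_zero 2 hd (by linarith)
        · rcases Int.emod_two_eq_zero_or_one s with hs | hs
          · rw [pow_two, Int.mul_emod, hs] at hl
            simp at hl
          · exact hs
        · rw [sq_abs]
          linear_combination -hsq
      rcases h5 with ⟨hm2, hn2⟩ | ⟨hm2, hn2⟩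
      · obtain ⟨k, rfl⟩ := Int.dvd_of_emod_eq_zero hm2
        exact key k n hmn.of_mul_left_right hn2 (by linarith) (.inl (by linarith)) h3
      · obtain ⟨k, rfl⟩ := Int.dvd_of_emod_eq_zero hn2
        exact key k m hmn.symm.of_mul_left_right hm2 (by linarith) (.inr hm) (by linarith)
    obtain ⟨e, f, hf, hef, heq, hlt⟩ :=
      Int.exists_pow_four_eq_of_add_four_mul hr hs hrs (abs_pos.mpr ha) hsum
    exact ih e.natAbs (by zify; exact hlt) e f s hf (by rintro rfl; simp at hs) hef rfl heq
  · have hodd : b ^ 2 % 2 = 1 := by rw [pow_two, Int.mul_emod, hb2]; rfl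
    have hp : PythagoreanTriple (b ^ 2) c (a ^ 2) := by
      unfold PythagoreanTriple
      linear_combination -h
    obtain ⟨m, n, h1, h2, h3, h4, -, -⟩ :=
      hp.coprime_classification' (Int.isCoprime_iff_gcd_eq_one.mp hbc) hodd ha2
    have hn : n ≠ 0 := by
      rintro rfl
      simp [hc] at h2
    have hn2 : 0 < n ^ 2 := by positivity
    refine ih m.natAbs (Int.natAbs_lt_iff_sq_lt.mpr (by linarith)) m n (a * b) hn
      (mul_ne_zero ha hb) (Int.isCoprime_iff_gcd_eq_one.mpr h4) rfl ?_
    rw [mul_pow, h1, h3]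
    ring

theorem stmt_14 (t : ℚ) (ht0 : t ≠ 0) (ht1 : t ≠ 1) (ht1' : t ≠ -1) :
    ¬ IsSquare (t ^ 4 - 1) := by
  rintro ⟨q, hq⟩
  have hden : (t.den : ℚ) ≠ 0 := by exact_mod_cast t.den_nz
  have hnum : (t.num : ℚ) = t * t.den := (Rat.mul_den_eq_num t).symm
  have hqs : IsSquare ((t.num ^ 4 - (t.den : ℤ) ^ 4 : ℤ) : ℚ) := by
    refine ⟨q * t.den ^ 2, ?_⟩
    push_cast
    rw [hnum]
    linear_combination (t.den : ℚ) ^ 4 * hq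
  obtain ⟨c, hc⟩ := Rat.isSquare_intCast_iff.mp hqs
  refine Int.pow_four_ne_pow_four_add_sq_of_isCoprime t.num t.den c (by exact_mod_cast t.den_nz)
    ?_ (Rat.isCoprime_num_den t) (by linear_combination hc)
  rintro rfl
  have h0 : (t.num : ℚ) ^ 4 - (t.den : ℚ) ^ 4 = 0 := by exact_mod_cast hc
  rw [hnum] at h0
  have h4 : t ^ 4 = 1 := by
    have : (t.den : ℚ) ^ 4 * (t ^ 4 - 1) = 0 := by linear_combination h0
    have := (mul_eq_zero.mp this).resolve_left (pow_ne_zero 4 hden)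
    linarith
  have h3 : (t - 1) * (t + 1) * (t ^ 2 + 1) = 0 := by linear_combination h4
  have : t ^ 2 + 1 ≠ 0 := by positivity
  rcases mul_eq_zero.mp ((mul_eq_zero.mp h3).resolve_right this) with h | h
  · exact ht1 (by linarith)
  · exact ht1' (by linarith)
end

section
/- Let s be a rational number with s ≠ 0, ±1 and let α be a rational number with α + 2s²(s²−1) ≠ 0. Set t = (sα − 2s(s²−1))/(α + 2s²(s²−1)) and γ = t²(s − 1/s)². Then γ − (t²−1)² = s⁻²·(s+t)(s−t)(ts+1)(ts−1) = s⁻²·(2s(s²−1)(s²+1))²·α(α−(2s)²)(α+(s²−1)²)/(α + 2s²(s²−1))⁴. In particular, if α(α−(2s)²)(α+(s²−1)²) is a square of a rational number, then so is γ − (t²−1)². -/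
theorem stmt_16 (s α : ℚ) (hs0 : s ≠ 0) (hs1 : s ≠ 1) (hs1' : s ≠ -1)
    (hα : α + 2 * s ^ 2 * (s ^ 2 - 1) ≠ 0) (t γ : ℚ)
    (ht : t = (s * α - 2 * s * (s ^ 2 - 1)) / (α + 2 * s ^ 2 * (s ^ 2 - 1)))
    (hγ : γ = t ^ 2 * (s - 1 / s) ^ 2) :
    γ - (t ^ 2 - 1) ^ 2 = s ^ (-2 : ℤ) * ((s + t) * (s - t) * (t * s + 1) * (t * s - 1)) ∧
    γ - (t ^ 2 - 1) ^ 2 =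
      s ^ (-2 : ℤ) * ((2 * s * (s ^ 2 - 1) * (s ^ 2 + 1)) ^ 2 *
        (α * (α - (2 * s) ^ 2) * (α + (s ^ 2 - 1) ^ 2)) / (α + 2 * s ^ 2 * (s ^ 2 - 1)) ^ 4) ∧
    (IsSquare (α * (α - (2 * s) ^ 2) * (α + (s ^ 2 - 1) ^ 2)) →
      IsSquare (γ - (t ^ 2 - 1) ^ 2)) := by
  have h₁ : γ - (t ^ 2 - 1) ^ 2 =
      s ^ (-2 : ℤ) * ((s + t) * (s - t) * (t * s + 1) * (t * s - 1)) := by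
    rw [hγ, show (s ^ (-2 : ℤ)) = 1 / s ^ 2 by simp [zpow_neg, zpow_ofNat]]
    field_simp
    ring
  have h₂ : γ - (t ^ 2 - 1) ^ 2 =
      s ^ (-2 : ℤ) * ((2 * s * (s ^ 2 - 1) * (s ^ 2 + 1)) ^ 2 *
        (α * (α - (2 * s) ^ 2) * (α + (s ^ 2 - 1) ^ 2)) /
          (α + 2 * s ^ 2 * (s ^ 2 - 1)) ^ 4) := by
    rw [h₁]
    congr 1
    generalize hD : α + 2 * s ^ 2 * (s ^ 2 - 1) = D at hα ht ⊢
    have e₁ : s + t = 2 * s * (α + (s ^ 2 - 1) ^ 2) / D := by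
      rw [ht, eq_div_iff hα, add_mul, div_mul_cancel₀ _ hα, ← hD]; ring
    have e₂ : s - t = 2 * s * (s ^ 2 - 1) * (s ^ 2 + 1) / D := by
      rw [ht, eq_div_iff hα, sub_mul, div_mul_cancel₀ _ hα, ← hD]; ring
    have e₃ : t * s + 1 = (s ^ 2 + 1) * α / D := by
      rw [ht, eq_div_iff hα, add_mul, mul_right_comm, div_mul_cancel₀ _ hα, ← hD]; ring
    have e₄ : t * s - 1 = (s ^ 2 - 1) * (α - (2 * s) ^ 2) / D := by
      rw [ht, eq_div_iff hα, sub_mul, mul_right_comm, div_mul_cancel₀ _ hα, ← hD]; ring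
    rw [e₁, e₂, e₃, e₄]
    ring
  refine ⟨h₁, h₂, ?_⟩
  rintro ⟨r, hr⟩
  refine ⟨s⁻¹ * (2 * s * (s ^ 2 - 1) * (s ^ 2 + 1)) * r /
    (α + 2 * s ^ 2 * (s ^ 2 - 1)) ^ 2, ?_⟩
  rw [h₂, hr, show (s ^ (-2 : ℤ)) = s⁻¹ ^ 2 by simp [zpow_neg, zpow_ofNat]]
  generalize α + 2 * s ^ 2 * (s ^ 2 - 1) = D
  generalize 2 * s * (s ^ 2 - 1) * (s ^ 2 + 1) = N
  ring
end
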